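/- arXiv:1111.4837 — 3 statements merged into one kernel-verified Lean document; each statement's English description precedes it below -/
import Mathlib

section
/- Let m > 0 and let ρ, F_τ, F_ξ : ℝ² → ℝ be differentiable functions with ρ² < 2m. Define the symmetric 2×2 matrix G(τ,ξ) with entries G₁₁ = −4ρ⁴/(2m−ρ²)·(∂ρ/∂τ)² + (2m−ρ²)·F_τ², G₁₂ = G₂₁ = −4ρ⁴/(2m−ρ²)·(∂ρ/∂τ)(∂ρ/∂ξ) + (2m−ρ²)·F_τ·F_ξ, G₂₂ = −4ρ⁴/(2m−ρ²)·(∂ρ/∂ξ)² + (2m−ρ²)·F_ξ². Then det G(τ,ξ) = −4ρ⁴·(F_τ·∂ρ/∂ξ − F_ξ·∂ρ/∂τ)². In particular, det G = 0 at every point where ρ = 0, so the extended metric is degenerate at the singularity. -/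
open Matrix

/-- Determinant of the extended Schwarzschild 2-metric:
`det G = −4ρ⁴·(Fτ·∂ρ/∂ξ − Fξ·∂ρ/∂τ)²`; in particular `det G = 0` where `ρ = 0`. -/
theorem schwarzschild_extension_det
    (m : ℝ) (hm : 0 < m)
    (ρ Fτ Fξ : ℝ × ℝ → ℝ)
    (hρ : Differentiable ℝ ρ) (hFτ : Differentiable ℝ Fτ) (hFξ : Differentiable ℝ Fξ)
    (hb : ∀ p : ℝ × ℝ, (ρ p) ^ 2 < 2 * m)
    (G : ℝ × ℝ → Matrix (Fin 2) (Fin 2) ℝ)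
    (hG : ∀ p : ℝ × ℝ, G p =
      !![-4 * (ρ p) ^ 4 / (2 * m - (ρ p) ^ 2) * (fderiv ℝ ρ p (1, 0)) ^ 2
           + (2 * m - (ρ p) ^ 2) * (Fτ p) ^ 2,
         -4 * (ρ p) ^ 4 / (2 * m - (ρ p) ^ 2)
             * (fderiv ℝ ρ p (1, 0)) * (fderiv ℝ ρ p (0, 1))
           + (2 * m - (ρ p) ^ 2) * Fτ p * Fξ p;
         -4 * (ρ p) ^ 4 / (2 * m - (ρ p) ^ 2)
             * (fderiv ℝ ρ p (1, 0)) * (fderiv ℝ ρ p (0, 1))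
           + (2 * m - (ρ p) ^ 2) * Fτ p * Fξ p,
         -4 * (ρ p) ^ 4 / (2 * m - (ρ p) ^ 2) * (fderiv ℝ ρ p (0, 1)) ^ 2
           + (2 * m - (ρ p) ^ 2) * (Fξ p) ^ 2]) :
    (∀ p : ℝ × ℝ, (G p).det =
      -4 * (ρ p) ^ 4 * (Fτ p * fderiv ℝ ρ p (0, 1) - Fξ p * fderiv ℝ ρ p (1, 0)) ^ 2) ∧
    (∀ p : ℝ × ℝ, ρ p = 0 → (G p).det = 0) := by
  have hdet : ∀ p : ℝ × ℝ, (G p).det =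
      -4 * (ρ p) ^ 4 * (Fτ p * fderiv ℝ ρ p (0, 1) - Fξ p * fderiv ℝ ρ p (1, 0)) ^ 2 := by
    intro p
    have hD : 2 * m - (ρ p) ^ 2 ≠ 0 := (sub_pos.mpr (hb p)).ne'
    rw [hG, Matrix.det_fin_two_of]
    field_simp
    ring
  refine ⟨hdet, fun p hp => ?_⟩
  simp [hdet, hp]
end

section
/- Let m > 0 and set T = 4. Define on the open set U = {(τ,ξ) ∈ ℝ² : τ² < 2m} the symmetric matrix-valued function G with entries G₁₁ = −4τ⁴/(2m−τ²) + 16ξ²(2m−τ²)τ⁴, G₁₂ = G₂₁ = 4ξ(2m−τ²)τ⁵, G₂₂ = (2m−τ²)τ⁶. For τ ≠ 0 let g^{st} denote the entries of G⁻¹ and define the Christoffel symbols of the first kind Γ_{abc} = (1/2)(∂_a G_{bc} + ∂_b G_{ca} − ∂_c G_{ab}), where indices range over {1,2} and ∂₁ = ∂/∂τ, ∂₂ = ∂/∂ξ. Then for every choice of indices a, b, c, d ∈ {1,2}, the function (τ,ξ) ↦ Σ_{s,t∈{1,2}} g^{st}(τ,ξ)·Γ_{abs}(τ,ξ)·Γ_{cdt}(τ,ξ),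 defined on U ∩ {τ ≠ 0}, extends to a real-analytic function on all of U (in particular across τ = 0). -/
open Matrix

/-- The `T = 4` extension of the Schwarzschild 2-metric in coordinates
`(τ,ξ)`, coming from the coordinate change `r = τ²`, `t = ξτ⁴`. -/
noncomputable def schwG (m : ℝ) (p : ℝ × ℝ) : Matrix (Fin 2) (Fin 2) ℝ :=
  !![-4 * p.1 ^ 4 / (2 * m - p.1 ^ 2) + 16 * p.2 ^ 2 * (2 * m - p.1 ^ 2) * p.1 ^ 4,
     4 * p.2 * (2 * m - p.1 ^ 2) * p.1 ^ 5;
     4 * p.2 * (2 * m - p.1 ^ 2) * p.1 ^ 5,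
     (2 * m - p.1 ^ 2) * p.1 ^ 6]

/-- The coordinate directions `∂₁ = ∂/∂τ`, `∂₂ = ∂/∂ξ`. -/
def dir : Fin 2 → ℝ × ℝ := ![(1, 0), (0, 1)]

/-- Partial derivative of a scalar function along the `i`-th coordinate. -/
noncomputable def pderiv (i : Fin 2) (f : ℝ × ℝ → ℝ) (p : ℝ × ℝ) : ℝ :=
  fderiv ℝ f p (dir i)

/-- Christoffel symbols of the first kind of the metric `schwG m`:
`Γ_{abc} = (1/2)(∂_a G_{bc} + ∂_b G_{ca} − ∂_c G_{ab})`. -/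
noncomputable def christoffel (m : ℝ) (a b c : Fin 2) (p : ℝ × ℝ) : ℝ :=
  (1 / 2) * (pderiv a (fun q => schwG m q b c) p
    + pderiv b (fun q => schwG m q c a) p
    - pderiv c (fun q => schwG m q a b) p)

/-- The cofactor of `τ⁴` in the metric `schwG m`. -/
noncomputable def schwGReduced (m : ℝ) (p : ℝ × ℝ) : Matrix (Fin 2) (Fin 2) ℝ :=
  !![-4 / (2 * m - p.1 ^ 2) + 16 * p.2 ^ 2 * (2 * m - p.1 ^ 2),
     4 * p.2 * (2 * m - p.1 ^ 2) * p.1;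
     4 * p.2 * (2 * m - p.1 ^ 2) * p.1,
     (2 * m - p.1 ^ 2) * p.1 ^ 2]

/-- The product of `τ⁶` with the inverse of the metric `schwG m`. -/
noncomputable def schwGInvScaled (m : ℝ) (p : ℝ × ℝ) : Matrix (Fin 2) (Fin 2) ℝ :=
  !![-(2 * m - p.1 ^ 2) * p.1 ^ 2 / 4,
     p.2 * (2 * m - p.1 ^ 2) * p.1;
     p.2 * (2 * m - p.1 ^ 2) * p.1,
     1 / (2 * m - p.1 ^ 2) - 4 * p.2 ^ 2 * (2 * m - p.1 ^ 2)]

theorem schwG_eq_pow_mul_reduced (m : ℝ) (j k : Fin 2) (p : ℝ × ℝ) :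
    schwG m p j k = p.1 ^ 4 * schwGReduced m p j k := by
  fin_cases j <;> fin_cases k <;> simp [schwG, schwGReduced] <;> ring

attribute [local fun_prop] analyticAt_fst analyticAt_snd

theorem analyticOnNhd_schwGReduced (m : ℝ) (j k : Fin 2) :
    AnalyticOnNhd ℝ (fun p => schwGReduced m p j k) {p : ℝ × ℝ | p.1 ^ 2 < 2 * m} := by
  intro p hp
  have hu : 2 * m - p.1 ^ 2 ≠ 0 := (sub_pos.mpr hp).ne'
  fin_cases j <;> fin_cases k <;> simp [schwGReduced] <;>
    fun_prop (disch := assumption)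

theorem analyticOnNhd_schwGInvScaled (m : ℝ) (s t : Fin 2) :
    AnalyticOnNhd ℝ (fun p => schwGInvScaled m p s t) {p : ℝ × ℝ | p.1 ^ 2 < 2 * m} := by
  intro p hp
  have hu : 2 * m - p.1 ^ 2 ≠ 0 := (sub_pos.mpr hp).ne'
  fin_cases s <;> fin_cases t <;> simp [schwGInvScaled] <;>
    fun_prop (disch := assumption)

theorem pow_mul_schwG_inv {m : ℝ} {p : ℝ × ℝ} (hp : p.1 ^ 2 < 2 * m) (hp0 : p.1 ≠ 0)
    (s t : Fin 2) : p.1 ^ 6 * (schwG m p)⁻¹ s t = schwGInvScaled m p s t := by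
  have hu : 2 * m - p.1 ^ 2 ≠ 0 := (sub_pos.mpr hp).ne'
  have hinv : (schwG m p)⁻¹ = (p.1 ^ 6)⁻¹ • schwGInvScaled m p := by
    refine Matrix.inv_eq_right_inv ?_
    ext i j
    fin_cases i <;> fin_cases j <;>
      simp [schwG, schwGInvScaled, Matrix.mul_apply, Fin.sum_univ_two] <;> field_simp <;> ring
  rw [hinv, Matrix.smul_apply, smul_eq_mul, mul_inv_cancel_left₀ (pow_ne_zero 6 hp0)]

theorem exists_analytic_pderiv_schwG (m : ℝ) (i j k : Fin 2) :
    ∃ D : ℝ × ℝ → ℝ, AnalyticOnNhd ℝ D {p : ℝ × ℝ | p.1 ^ 2 < 2 * m} ∧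
      ∀ p : ℝ × ℝ, p.1 ^ 2 < 2 * m →
        pderiv i (fun q => schwG m q j k) p = p.1 ^ 3 * D p := by
  have hR := analyticOnNhd_schwGReduced m j k
  refine ⟨fun p => 4 * (dir i).1 * schwGReduced m p j k
    + p.1 * pderiv i (fun q => schwGReduced m q j k) p, ?_, fun p hp => ?_⟩
  · have hD : AnalyticOnNhd ℝ (pderiv i (fun q => schwGReduced m q j k))
        {p : ℝ × ℝ | p.1 ^ 2 < 2 * m} := fun p hp =>
      ((ContinuousLinearMap.apply ℝ ℝ (dir i)).analyticAt _).comp (hR.fderiv p hp)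
    exact (analyticOnNhd_const.mul hR).add (analyticOnNhd_fst.mul hD)
  · have hpow : HasFDerivAt (fun q : ℝ × ℝ => q.1 ^ 4) _ p :=
      (hasFDerivAt_fst (𝕜 := ℝ) (p := p)).pow 4
    have hmul := hpow.fun_mul (hR p hp).differentiableAt.hasFDerivAt
    simp only [pderiv, schwG_eq_pow_mul_reduced]
    rw [hmul.fderiv]
    simp
    ring

theorem exists_analytic_christoffel (m : ℝ) (a b c : Fin 2) :
    ∃ C : ℝ × ℝ → ℝ, AnalyticOnNhd ℝ C {p : ℝ × ℝ | p.1 ^ 2 < 2 * m} ∧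
      ∀ p : ℝ × ℝ, p.1 ^ 2 < 2 * m → christoffel m a b c p = p.1 ^ 3 * C p := by
  obtain ⟨D₁, h₁, e₁⟩ := exists_analytic_pderiv_schwG m a b c
  obtain ⟨D₂, h₂, e₂⟩ := exists_analytic_pderiv_schwG m b c a
  obtain ⟨D₃, h₃, e₃⟩ := exists_analytic_pderiv_schwG m c a b
  refine ⟨fun p => (1 / 2) * (D₁ p + D₂ p - D₃ p),
    analyticOnNhd_const.mul ((h₁.add h₂).sub h₃), fun p hp => ?_⟩
  rw [christoffel, e₁ p hp, e₂ p hp, e₃ p hp]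
  ring

/-- For the `T = 4` extension of the Schwarzschild 2-metric,
each product `Σ_{s,t} g^{st} Γ_{abs} Γ_{cdt}`, a priori defined only on
`{τ² < 2m} ∩ {τ ≠ 0}`, extends to a real-analytic function on all of
`{τ² < 2m}` — semi-regularity at the singularity `r = 0`. -/
theorem schwarzschild_T4_semi_regular (m : ℝ) (hm : 0 < m) :
    ∀ a b c d : Fin 2, ∃ h : ℝ × ℝ → ℝ,
      AnalyticOnNhd ℝ h {p : ℝ × ℝ | p.1 ^ 2 < 2 * m} ∧
      ∀ p : ℝ × ℝ, p.1 ^ 2 < 2 * m → p.1 ≠ 0 →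
        h p = ∑ s : Fin 2, ∑ t : Fin 2,
          (schwG m p)⁻¹ s t * christoffel m a b s p * christoffel m c d t p := by
  intro a b c d
  choose C hC eC using exists_analytic_christoffel m
  refine ⟨fun p => ∑ s : Fin 2, ∑ t : Fin 2, schwGInvScaled m p s t * C a b s p * C c d t p,
    fun p hp => ?_, fun p hp hp0 => ?_⟩
  · exact Finset.analyticAt_fun_sum _ fun s _ => Finset.analyticAt_fun_sum _ fun t _ =>
      ((analyticOnNhd_schwGInvScaled m s t p hp).mul (hC a b s p hp)).mul (hC c d t p hp)
  · refine Finset.sum_congr rfl fun s _ => Finset.sum_congr rfl fun t _ => ?_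
    rw [eC a b s p hp, eC c d t p hp, ← pow_mul_schwG_inv hp hp0]
    ring
end

section
/- Let m > 0, let T ≥ 2 be a natural number, and let (τ,ξ) satisfy 0 < τ² < 2m. With g_tt = (2m−r)/r and g_rr = −r/(2m−r) evaluated at r = τ², and J the Jacobian matrix of the map (τ,ξ) ↦ (t,r) = (ξτ^T, τ²), the determinant of the pulled-back metric satisfies det(Jᵀ·diag(g_tt, g_rr)·J) = g_tt·g_rr·(det J)² = −4τ⁴·(F_τ·∂r̃/∂ξ − F_ξ·∂r̃/∂τ)²·τ^{−2}·... = −4τ^{2T+2}, i.e. the determinant of the pullback of the Schwarzschild 2-metric under this coordinate change equals −4τ^{2T+2}. -/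
open Matrix

/-- The determinant of the pullback of the Schwarzschild
2-metric under the coordinate change `(τ,ξ) ↦ (t,r) = (ξτ^T, τ²)` equals
`g_tt·g_rr·(det J)² = −4τ^(2T+2)` on `0 < τ² < 2m`. -/
theorem schwarzschild_pullback_det
    (m : ℝ) (hm : 0 < m) (T : ℕ) (hT : 2 ≤ T)
    (t r : ℝ × ℝ → ℝ)
    (ht : t = fun p : ℝ × ℝ => p.2 * p.1 ^ T)
    (hr : r = fun p : ℝ × ℝ => p.1 ^ 2)
    (p : ℝ × ℝ) (h0 : 0 < p.1 ^ 2) (h2m : p.1 ^ 2 < 2 * m) :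
    let J : Matrix (Fin 2) (Fin 2) ℝ :=
      !![fderiv ℝ t p (1, 0), fderiv ℝ t p (0, 1);
         fderiv ℝ r p (1, 0), fderiv ℝ r p (0, 1)]
    let D : Matrix (Fin 2) (Fin 2) ℝ :=
      !![(2 * m - r p) / r p, 0;
         0, -(r p) / (2 * m - r p)]
    (Jᵀ * D * J).det = ((2 * m - r p) / r p) * (-(r p) / (2 * m - r p)) * (J.det) ^ 2 ∧
    (Jᵀ * D * J).det = -4 * p.1 ^ (2 * T + 2) := by
  intro J D
  have hdet : (Jᵀ * D * J).det =
      ((2 * m - r p) / r p) * (-(r p) / (2 * m - r p)) * (J.det) ^ 2 := by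
    have hD : D.det = ((2 * m - r p) / r p) * (-(r p) / (2 * m - r p)) := by
      simp [D, det_fin_two_of]
    rw [det_mul, det_mul, det_transpose, hD]
    ring
  refine ⟨hdet, ?_⟩
  have hfst : HasFDerivAt (fun q : ℝ × ℝ => q.1) (ContinuousLinearMap.fst ℝ ℝ ℝ) p :=
    hasFDerivAt_fst
  have hsnd : HasFDerivAt (fun q : ℝ × ℝ => q.2) (ContinuousLinearMap.snd ℝ ℝ ℝ) p :=
    hasFDerivAt_snd
  have htξ : fderiv ℝ t p (0, 1) = p.1 ^ T := by
    rw [ht, (hsnd.fun_mul (hfst.pow T)).fderiv]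
    simp
  have hrτ : fderiv ℝ r p (1, 0) = 2 * p.1 := by
    rw [hr, (hfst.pow 2).fderiv]
    simp
  have hrξ : fderiv ℝ r p (0, 1) = 0 := by
    rw [hr, (hfst.pow 2).fderiv]
    simp
  have hJ : J.det = -(p.1 ^ T * (2 * p.1)) := by
    simp [J, det_fin_two_of, htξ, hrτ, hrξ]
  have hrp : r p = p.1 ^ 2 := by rw [hr]
  have hr0 : r p ≠ 0 := by rw [hrp]; exact h0.ne'
  have hmr : 2 * m - r p ≠ 0 := by rw [hrp]; exact (sub_pos.2 h2m).ne'
  have hprod : ((2 * m - r p) / r p) * (-(r p) / (2 * m - r p)) = -1 := by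
    field_simp
  rw [hdet, hprod, hJ]
  ring
end
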